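/- arXiv:2502.09343 — 5 statements merged into one kernel-verified Lean document; each statement's English description precedes it below -/
import Mathlib

section
/- For every integer h ≥ 1, Δ_x Δ_y gt_h(x,y) = gt_{h−1}(x,y) as polynomials in x and y. -/
open MvPolynomial

noncomputable section

/-- The generalized binomial coefficient `binom(x,m) = x(x-1)⋯(x-m+1)/m!`. -/
def qbinom (x : ℚ) (m : ℕ) : ℚ := (∏ j ∈ Finset.range m, (x - j)) / m.factorial

/-- `gtChar gt` says that `gt h` is the (unique) bivariate polynomial `gt_h(x,y)`. -/
def gtChar (gt : ℕ → MvPolynomial (Fin 2) ℚ) : Prop :=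
  gt 0 = 1 ∧
    ∀ h : ℕ, 1 ≤ h → ∀ x y : ℤ, (h : ℤ) ≤ x →
      MvPolynomial.eval ![(x : ℚ), (y : ℚ)] (gt h) =
        ∑ p ∈ Finset.Icc (h : ℤ) (x - 1),
          (qbinom ((x : ℚ) - (p : ℚ) + (h : ℚ) - 1) h * qbinom ((y : ℚ) - (p : ℚ) + (h : ℚ) - 2) h -
            qbinom ((x : ℚ) - (p : ℚ) + (h : ℚ) - 2) h * qbinom ((y : ℚ) - (p : ℚ) + (h : ℚ) - 1) h)

/-- The shift operator `E_s` on polynomials: substitute `X s + 1` for `X s`. -/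
def shiftF {σ : Type*} [DecidableEq σ] (s : σ) (p : MvPolynomial σ ℚ) : MvPolynomial σ ℚ :=
  MvPolynomial.aeval (fun t => if t = s then MvPolynomial.X t + 1 else MvPolynomial.X t) p

/-- The forward difference operator `Δ_s = E_s - id`. -/
def fdiffF {σ : Type*} [DecidableEq σ] (s : σ) (p : MvPolynomial σ ℚ) : MvPolynomial σ ℚ :=
  shiftF s p - p

/-- The Pascal rule for generalized binomial coefficients. -/
lemma qbinom_add_one_succ (z : ℚ) (m : ℕ) :
    qbinom (z + 1) (m + 1) = qbinom z (m + 1) + qbinom z m := by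
  have hprod : ∏ j ∈ Finset.range m, (z + 1 - ((j + 1 : ℕ) : ℚ)) =
      ∏ j ∈ Finset.range m, (z - j) :=
    Finset.prod_congr rfl fun j _ => by push_cast; ring
  have hm : (m.factorial : ℚ) ≠ 0 := by exact_mod_cast m.factorial_ne_zero
  have hm' : (m : ℚ) + 1 ≠ 0 := by positivity
  unfold qbinom
  rw [Finset.prod_range_succ', Finset.prod_range_succ, hprod, Nat.factorial_succ]
  push_cast
  field_simp
  ring

lemma qbinom_natCast_eq_zero {n m : ℕ} (hnm : n < m) : qbinom n m = 0 := by
  unfold qbinom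
  rw [Finset.prod_eq_zero (Finset.mem_range.2 hnm) (sub_self _), zero_div]

/-- The summand in the definition of `gt_h(x,y)`, in terms of `a = x - p` and `b = y - p`. -/
def gtTerm (h : ℕ) (a b : ℚ) : ℚ :=
  qbinom (a + h - 1) h * qbinom (b + h - 2) h - qbinom (a + h - 2) h * qbinom (b + h - 1) h

/-- The mixed difference of the summand of index `h + 1` is a shifted summand of index `h`. -/
lemma gtTerm_mixed_diff (h : ℕ) (a b : ℚ) :
    gtTerm (h + 1) (a + 1) (b + 1) - gtTerm (h + 1) (a + 1) b
      - (gtTerm (h + 1) a (b + 1) - gtTerm (h + 1) a b) = gtTerm h (a + 1) (b + 1) := by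
  have step (z c : ℚ) : qbinom (z + 1 + ((h + 1 : ℕ) : ℚ) - c) (h + 1) =
      qbinom (z + ((h + 1 : ℕ) : ℚ) - c) (h + 1) + qbinom (z + 1 + h - c) h := by
    have := qbinom_add_one_succ (z + 1 + h - c) h
    convert this using 2 <;> push_cast <;> ring_nf
  simp only [gtTerm, step]
  ring

lemma gtTerm_zero_left {h : ℕ} (hh : 2 ≤ h) (b : ℚ) : gtTerm h 0 b = 0 := by
  obtain ⟨k, rfl⟩ := Nat.exists_eq_add_of_le' hh
  have h1 : (0 : ℚ) + ((k + 2 : ℕ) : ℚ) - 1 = ((k + 1 : ℕ) : ℚ) := by push_cast; ring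
  have h2 : (0 : ℚ) + ((k + 2 : ℕ) : ℚ) - 2 = (k : ℚ) := by push_cast; ring
  rw [gtTerm, h1, h2, qbinom_natCast_eq_zero (by omega), qbinom_natCast_eq_zero (by omega)]
  ring

lemma eval_shiftF_zero (p : MvPolynomial (Fin 2) ℚ) (x y : ℚ) :
    eval ![x, y] (shiftF 0 p) = eval ![x + 1, y] p := by
  rw [shiftF, ← coe_aeval_eq_eval, ← coe_aeval_eq_eval, RingHom.coe_coe, RingHom.coe_coe,
    ← AlgHom.comp_apply, comp_aeval]
  congr 2
  ext i
  fin_cases i <;> simp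

lemma eval_shiftF_one (p : MvPolynomial (Fin 2) ℚ) (x y : ℚ) :
    eval ![x, y] (shiftF 1 p) = eval ![x, y + 1] p := by
  rw [shiftF, ← coe_aeval_eq_eval, ← coe_aeval_eq_eval, RingHom.coe_coe, RingHom.coe_coe,
    ← AlgHom.comp_apply, comp_aeval]
  congr 2
  ext i
  fin_cases i <;> simp

/-- A bivariate polynomial is determined by its values at integer points `(x, y)` with `x` large. -/
lemma eq_of_eval_int_eq {p q : MvPolynomial (Fin 2) ℚ} (N : ℤ)
    (hpq : ∀ x y : ℤ, N ≤ x → eval ![(x : ℚ), (y : ℚ)] p = eval ![(x : ℚ), (y : ℚ)] q) :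
    p = q := by
  refine MvPolynomial.funext_set (fun _ => (fun n : ℤ => (n : ℚ)) '' Set.Ici N)
    (fun _ => (Set.Ici_infinite N).image Int.cast_injective.injOn) fun v hv => ?_
  obtain ⟨x, hx, hx'⟩ := hv 0 trivial
  obtain ⟨y, -, hy'⟩ := hv 1 trivial
  have hv' : v = ![(x : ℚ), (y : ℚ)] := by
    ext i
    fin_cases i <;> simp [← hx', ← hy']
  rw [hv']
  exact hpq x y hx

lemma sum_Icc_eq_sum_Icc_sub_one_add {a b : ℤ} (hab : a ≤ b) (f : ℤ → ℚ) :
    ∑ p ∈ Finset.Icc a b, f p = ∑ p ∈ Finset.Icc a (b - 1), f p + f b := by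
  have : Finset.Icc a b = insert b (Finset.Icc a (b - 1)) := by
    ext p
    simp only [Finset.mem_insert, Finset.mem_Icc]
    omega
  rw [this, Finset.sum_insert (by simp), add_comm]

lemma sum_Icc_sub_one_sub_one (a b : ℤ) (f : ℤ → ℚ) :
    ∑ p ∈ Finset.Icc (a - 1) (b - 1), f p = ∑ p ∈ Finset.Icc a b, f (p - 1) := by
  refine Finset.sum_nbij' (· + 1) (· - 1) ?_ ?_ ?_ ?_ ?_ <;>
    simp only [Finset.mem_Icc] <;> intros <;> first | omega | simp

lemma gtChar.eval_eq {gt : ℕ → MvPolynomial (Fin 2) ℚ} (hgt : gtChar gt) {h : ℕ} (hh : 1 ≤ h)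
    {x : ℤ} (hx : (h : ℤ) ≤ x) (y : ℤ) :
    eval ![(x : ℚ), (y : ℚ)] (gt h) =
      ∑ p ∈ Finset.Icc (h : ℤ) (x - 1), gtTerm h ((x : ℚ) - p) ((y : ℚ) - p) :=
  hgt.2 h hh x y hx

lemma eval_fdiffF_fdiffF (p : MvPolynomial (Fin 2) ℚ) (x y : ℤ) :
    eval ![(x : ℚ), (y : ℚ)] (fdiffF 0 (fdiffF 1 p)) =
      eval ![((x + 1 : ℤ) : ℚ), ((y + 1 : ℤ) : ℚ)] p - eval ![((x + 1 : ℤ) : ℚ), (y : ℚ)] p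
        - (eval ![(x : ℚ), ((y + 1 : ℤ) : ℚ)] p - eval ![(x : ℚ), (y : ℚ)] p) := by
  have hzero : fdiffF 0 (fdiffF 1 p) = shiftF 0 (fdiffF 1 p) - fdiffF 1 p := rfl
  have hone : fdiffF 1 p = shiftF 1 p - p := rfl
  rw [hzero, map_sub, eval_shiftF_zero, hone, map_sub, map_sub, eval_shiftF_one, eval_shiftF_one]
  push_cast
  rfl

/-- The mixed difference of `gt_h`, with the boundary term `p = x` split off. -/
lemma gtChar.eval_fdiffF_fdiffF {gt : ℕ → MvPolynomial (Fin 2) ℚ} (hgt : gtChar gt) (k : ℕ)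
    {x : ℤ} (hx : ((k + 1 : ℕ) : ℤ) ≤ x) (y : ℤ) :
    eval ![(x : ℚ), (y : ℚ)] (fdiffF 0 (fdiffF 1 (gt (k + 1)))) =
      ∑ p ∈ Finset.Icc ((k + 1 : ℕ) : ℤ) (x - 1), gtTerm k ((x : ℚ) - p + 1) ((y : ℚ) - p + 1) +
        (gtTerm (k + 1) 1 ((y : ℚ) - x + 1) - gtTerm (k + 1) 1 ((y : ℚ) - x)) := by
  have hk : 1 ≤ k + 1 := by omega
  have hx' : ((k + 1 : ℕ) : ℤ) ≤ x + 1 := by omega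
  rw [_root_.eval_fdiffF_fdiffF, hgt.eval_eq hk hx', hgt.eval_eq hk hx', hgt.eval_eq hk hx,
    hgt.eval_eq hk hx, add_sub_cancel_right, sum_Icc_eq_sum_Icc_sub_one_add hx,
    sum_Icc_eq_sum_Icc_sub_one_add hx]
  rw [Finset.sum_congr rfl fun (p : ℤ) _ =>
    (gtTerm_mixed_diff k ((x : ℚ) - p) ((y : ℚ) - p)).symm]
  simp only [Finset.sum_sub_distrib]
  push_cast
  simp only [add_sub_right_comm _ (1 : ℚ), sub_self, zero_add]
  ring

/-- For every `h ≥ 1`, `Δ_x Δ_y gt_h(x,y) = gt_{h-1}(x,y)`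
as polynomials in `x` and `y`. -/
theorem statement5 (gt : ℕ → MvPolynomial (Fin 2) ℚ) (hgt : gtChar gt) (h : ℕ) (hh : 1 ≤ h) :
    fdiffF 0 (fdiffF 1 (gt h)) = gt (h - 1) := by
  obtain ⟨k, rfl⟩ := Nat.exists_eq_add_of_le' hh
  refine eq_of_eval_int_eq ((k + 1 : ℕ) : ℤ) fun x y hx => ?_
  rw [hgt.eval_fdiffF_fdiffF k hx, Nat.add_sub_cancel]
  rcases Nat.eq_zero_or_pos k with rfl | hk
  · rw [hgt.1]
    simp [gtTerm, qbinom]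
    ring
  · have hbd := gtTerm_mixed_diff k 0 ((y : ℚ) - x)
    rw [gtTerm_zero_left (by omega), gtTerm_zero_left (by omega), zero_add, sub_self,
      sub_zero] at hbd
    have hkx : (k : ℤ) = ((k + 1 : ℕ) : ℤ) - 1 := by push_cast; ring
    rw [hgt.eval_eq hk (by omega), hkx, sum_Icc_sub_one_sub_one,
      sum_Icc_eq_sum_Icc_sub_one_add hx, hbd]
    push_cast
    simp only [← sub_add, sub_self, zero_add]
end
end

section
/- For every integer h ≥ 1, the following two identities hold as polynomials in x and y: Δ_x Δ_y sgt_h(x,y) = sgt_{h−1}(x,y), and (Δ_x + Δ_y) sgt_h(x,y) = −sgt_{h−1}(x,y). -/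
open MvPolynomial

noncomputable section

/-- The polynomial `sgt_h(x,y) = (-1)^h (1/(2h)!) (x-y-h+1)_{2h-1} (x-y)` (and `sgt_0 = 1`),
as a polynomial in the two variables `X 0 = x` and `X 1 = y`. -/
def sgtF (h : ℕ) : MvPolynomial (Fin 2) ℚ :=
  if h = 0 then 1
  else ((-1 : ℚ) ^ h / (2 * h).factorial) •
    ((∏ j ∈ Finset.range (2 * h - 1),
        (X 0 - X 1 - (h : MvPolynomial (Fin 2) ℚ) + 1 + (j : MvPolynomial (Fin 2) ℚ))) *
      (X 0 - X 1))

/-- The product `(z - k) (z - k + 1) ⋯ (z + k)` of `2k + 1` consecutive factors centred at `z`. -/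
def centralProd {R : Type*} [CommRing R] (k : ℕ) (z : R) : R :=
  ∏ j ∈ Finset.range (2 * k + 1), (z - k + j)

section CentralProd

variable {R : Type*} [CommRing R]

theorem map_centralProd {S F : Type*} [CommRing S] [FunLike F R S] [RingHomClass F R S]
    (f : F) (k : ℕ) (z : R) : f (centralProd k z) = centralProd k (f z) := by
  simp [centralProd]

theorem centralProd_succ (k : ℕ) (z : R) :
    centralProd (k + 1) z = (z - k - 1) * centralProd k z * (z + k + 1) := by
  unfold centralProd
  rw [show 2 * (k + 1) + 1 = 2 * k + 1 + 1 + 1 by ring, Finset.prod_range_succ,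
    Finset.prod_range_succ', mul_comm (∏ _ ∈ _, _)]
  congr 1
  · congr 1
    · push_cast; ring
    · exact Finset.prod_congr rfl fun j _ => by push_cast; ring
  · push_cast; ring

theorem centralProd_succ_add_one (k : ℕ) (z : R) :
    centralProd (k + 1) (z + 1) = centralProd k z * (z + k + 1) * (z + k + 2) := by
  unfold centralProd
  rw [show 2 * (k + 1) + 1 = 2 * k + 1 + 1 + 1 by ring, Finset.prod_range_succ,
    Finset.prod_range_succ]
  congr 1
  · congr 1
    · exact Finset.prod_congr rfl fun j _ => by push_cast; ring
    · push_cast; ring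
  · push_cast; ring

theorem centralProd_succ_sub_one (k : ℕ) (z : R) :
    centralProd (k + 1) (z - 1) = centralProd k z * (z - k - 1) * (z - k - 2) := by
  unfold centralProd
  rw [show 2 * (k + 1) + 1 = 2 * k + 1 + 1 + 1 by ring, Finset.prod_range_succ',
    Finset.prod_range_succ']
  congr 1
  · congr 1
    · exact Finset.prod_congr rfl fun j _ => by push_cast; ring
    · push_cast; ring
  · push_cast; ring

theorem centralProd_second_difference (k : ℕ) (z : R) :
    centralProd (k + 1) (z + 1) * (z + 1) + centralProd (k + 1) (z - 1) * (z - 1)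
      - 2 * (centralProd (k + 1) z * z) =
    ((2 * k + 4) * (2 * k + 3)) * (centralProd k z * z) := by
  rw [centralProd_succ_add_one, centralProd_succ_sub_one, centralProd_succ]
  ring

end CentralProd

theorem sgtF_zero : sgtF 0 = 1 := if_pos rfl

theorem sgtF_succ (k : ℕ) :
    sgtF (k + 1) = ((-1 : ℚ) ^ (k + 1) / (2 * (k + 1)).factorial) •
      (centralProd k (X 0 - X 1) * (X 0 - X 1)) := by
  rw [sgtF, if_neg k.succ_ne_zero, show 2 * (k + 1) - 1 = 2 * k + 1 by omega, centralProd]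
  congr 2
  exact Finset.prod_congr rfl fun j _ => by push_cast; ring

theorem shiftF_zero_sgtF_succ (k : ℕ) :
    shiftF 0 (sgtF (k + 1)) = ((-1 : ℚ) ^ (k + 1) / (2 * (k + 1)).factorial) •
      (centralProd k (X 0 - X 1 + 1) * (X 0 - X 1 + 1)) := by
  simp [shiftF, sgtF_succ, map_centralProd, add_sub_right_comm]

theorem shiftF_one_sgtF_succ (k : ℕ) :
    shiftF 1 (sgtF (k + 1)) = ((-1 : ℚ) ^ (k + 1) / (2 * (k + 1)).factorial) •
      (centralProd k (X 0 - X 1 - 1) * (X 0 - X 1 - 1)) := by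
  simp [shiftF, sgtF_succ, map_centralProd, sub_add_eq_sub_sub]

theorem shiftF_zero_shiftF_one_sgtF_succ (k : ℕ) :
    shiftF 0 (shiftF 1 (sgtF (k + 1))) = sgtF (k + 1) := by
  rw [shiftF_one_sgtF_succ, sgtF_succ]
  simp [shiftF, map_centralProd, add_sub_right_comm]

theorem fdiffF_add_fdiffF_sgtF_succ (k : ℕ) :
    fdiffF (0 : Fin 2) (sgtF (k + 1)) + fdiffF 1 (sgtF (k + 1)) = -sgtF k := by
  rw [fdiffF, fdiffF, shiftF_zero_sgtF_succ, shiftF_one_sgtF_succ, sgtF_succ]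
  cases k with
  | zero =>
    rw [sgtF_zero]
    simp only [centralProd, ← smul_sub, ← smul_add]
    have : (-1 : MvPolynomial (Fin 2) ℚ) = (-1 / 2 : ℚ) • 2 := by
      rw [MvPolynomial.smul_eq_C_mul, ← map_ofNat C 2, ← map_mul]
      norm_num
    rw [this]
    congr 1
    simp only [mul_zero, zero_add, Finset.prod_range_one, Nat.cast_zero]
    ring
  | succ k =>
    rw [sgtF_succ, ← smul_sub, ← smul_sub, ← smul_add]
    have key := centralProd_second_difference k (X 0 - X 1 : MvPolynomial (Fin 2) ℚ)
    have hc : ((2 * k + 4) * (2 * k + 3) : MvPolynomial (Fin 2) ℚ) =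
        C ((2 * k + 4) * (2 * k + 3) : ℚ) := by
      simp only [map_mul, map_add, map_natCast, map_ofNat]
    rw [hc, ← MvPolynomial.smul_eq_C_mul] at key
    rw [sub_add_sub_comm, ← two_mul, key, smul_smul, ← neg_smul]
    congr 1
    rw [show 2 * (k + 1 + 1) = 2 * (k + 1) + 1 + 1 by ring, Nat.factorial_succ,
      Nat.factorial_succ]
    have := Nat.cast_ne_zero (R := ℚ).2 (2 * (k + 1)).factorial_ne_zero
    push_cast
    field_simp
    ring

theorem fdiffF_zero_fdiffF_one_sgtF_succ (k : ℕ) :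
    fdiffF 0 (fdiffF 1 (sgtF (k + 1))) =
      -(fdiffF 0 (sgtF (k + 1)) + fdiffF 1 (sgtF (k + 1))) := by
  have h : shiftF 0 (shiftF 1 (sgtF (k + 1)) - sgtF (k + 1)) =
      shiftF 0 (shiftF 1 (sgtF (k + 1))) - shiftF 0 (sgtF (k + 1)) := map_sub _ _ _
  rw [fdiffF, fdiffF, h, shiftF_zero_shiftF_one_sgtF_succ, fdiffF]
  ring

/-- For every `h ≥ 1`: `Δ_x Δ_y sgt_h(x,y) = sgt_{h-1}(x,y)` and
`(Δ_x + Δ_y) sgt_h(x,y) = -sgt_{h-1}(x,y)`, as polynomials in `x` and `y`. -/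
theorem statement6 (h : ℕ) (hh : 1 ≤ h) :
    fdiffF 0 (fdiffF 1 (sgtF h)) = sgtF (h - 1) ∧
    fdiffF (0 : Fin 2) (sgtF h) + fdiffF 1 (sgtF h) = -sgtF (h - 1) := by
  obtain ⟨k, rfl⟩ := Nat.exists_eq_add_of_le' hh
  rw [Nat.add_sub_cancel, fdiffF_zero_fdiffF_one_sgtF_succ, fdiffF_add_fdiffF_sgtF_succ, neg_neg]
  exact ⟨rfl, rfl⟩
end
end

section
/- Let h be an integer and let f(z) be a polynomial in one variable z over ℚ. Then, as polynomials in x, y, z: W_{x,z} W_{y,z} [ Σ_{i≥0} (−1)^i · sgt_{h−i}(x,y) · ((Δ_z(1+Δ_z))^i f)(z) ] = sgt_h(x,y) · f(z), where the sum is finite (sgt_{h−i} = 0 for i > h, and (Δ_z(1+Δ_z))^i annihilates f for i large). Equivalently, W^{−1}_{x,z} W^{−1}_{y,z} (sgt_h(x,y) f(z)) = Σ_{i≥0} (−1)^i sgt_{h−i}(x,y) (Δ_z(1+Δ_z))^i f(z). -/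
open MvPolynomial

noncomputable section

/-- The polynomial `sgt_h(u,v)` in the variables `X u` and `X v` (with `sgt_0 = 1` and
`sgt_h = 0` for `h < 0`). -/
def sgtQ (h : ℤ) (u v : ℕ) : MvPolynomial ℕ ℚ :=
  if h < 0 then 0
  else if h = 0 then 1
  else ((-1 : ℚ) ^ h.toNat / (2 * h.toNat).factorial) •
    ((∏ j ∈ Finset.range (2 * h.toNat - 1),
        (X u - X v - (h : MvPolynomial ℕ ℚ) + 1 + (j : MvPolynomial ℕ ℚ))) *
      (X u - X v))

/-- The shift operator `E_s` on polynomials: substitute `X s + 1` for `X s`. -/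
def shiftV (s : ℕ) (p : MvPolynomial ℕ ℚ) : MvPolynomial ℕ ℚ :=
  MvPolynomial.aeval (fun t => if t = s then MvPolynomial.X t + 1 else MvPolynomial.X t) p

/-- The forward difference operator `Δ_s = E_s - id`. -/
def fdiffV (s : ℕ) (p : MvPolynomial ℕ ℚ) : MvPolynomial ℕ ℚ :=
  shiftV s p - p

/-- The operator `W_{x,y} = id + Δ_x + Δ_x Δ_y`. -/
def Wop (x y : ℕ) (p : MvPolynomial ℕ ℚ) : MvPolynomial ℕ ℚ :=
  p + fdiffV x p + fdiffV x (fdiffV y p)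

/-- The operator `Δ_z (1 + Δ_z)` in the variable `z = X 2`. -/
def Dz (p : MvPolynomial ℕ ℚ) : MvPolynomial ℕ ℚ :=
  fdiffV 2 p + fdiffV 2 (fdiffV 2 p)

/-- The substitution `X s ↦ X s + 1` as an algebra homomorphism. -/
def shiftHom (s : ℕ) : MvPolynomial ℕ ℚ →ₐ[ℚ] MvPolynomial ℕ ℚ :=
  MvPolynomial.aeval (fun t => if t = s then MvPolynomial.X t + 1 else MvPolynomial.X t)

theorem shiftV_eq_shiftHom (s : ℕ) (p : MvPolynomial ℕ ℚ) : shiftV s p = shiftHom s p := rfl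

theorem shiftHom_X_self (s : ℕ) : shiftHom s (X s) = X s + 1 := by
  simp [shiftHom]

theorem shiftHom_X_of_ne {s t : ℕ} (hst : t ≠ s) : shiftHom s (X t) = X t := by
  simp [shiftHom, hst]

/-- `W_{0,2} W_{1,2}` acts as `id + Δ_0 Δ_1 Δ_2 (1 + Δ_2)` on products of a polynomial in
`X 0 - X 1` and a polynomial in `X 2`. -/
theorem Wop_Wop_mul {p q : MvPolynomial ℕ ℚ} (hp : shiftHom 2 p = p)
    (hp₁ : shiftHom 2 (shiftHom 1 p) = shiftHom 1 p) (hp₀₁ : shiftHom 0 (shiftHom 1 p) = p)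
    (hq : ∃ g : Polynomial ℚ, q = Polynomial.aeval (X 2) g) :
    Wop 0 2 (Wop 1 2 (p * q)) = p * q + fdiffV 0 (fdiffV 1 p) * Dz q := by
  obtain ⟨g, rfl⟩ := hq
  have haeval (s : ℕ) (c : MvPolynomial ℕ ℚ) :
      shiftHom s (Polynomial.aeval c g) = Polynomial.aeval (shiftHom s c) g :=
    (Polynomial.aeval_algHom_apply _ _ _).symm
  have hX₀ : shiftHom 0 (X 2) = X 2 := shiftHom_X_of_ne (by decide)
  have hX₁ : shiftHom 1 (X 2) = X 2 := shiftHom_X_of_ne (by decide)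
  simp only [Wop, Dz, fdiffV, shiftV_eq_shiftHom, map_add, map_sub, map_mul, map_one, hp, hp₁,
    hp₀₁, haeval, shiftHom_X_self, hX₀, hX₁]
  ring

theorem exists_aeval_eq_iterate_Dz (f : Polynomial ℚ) (i : ℕ) :
    ∃ g : Polynomial ℚ, Dz^[i] (Polynomial.aeval (X 2 : MvPolynomial ℕ ℚ) f) =
      Polynomial.aeval (X 2) g := by
  induction i with
  | zero => exact ⟨f, rfl⟩
  | succ i ih =>
    obtain ⟨g, hg⟩ := ih
    have hshift (k : Polynomial ℚ) : shiftHom 2 (Polynomial.aeval (X 2) k) =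
        Polynomial.aeval (X 2) (k.comp (Polynomial.X + 1)) := by
      rw [← Polynomial.aeval_algHom_apply, shiftHom_X_self, Polynomial.aeval_comp]
      simp
    rw [Function.iterate_succ_apply', hg]
    simp only [Dz, fdiffV, shiftV_eq_shiftHom, hshift, ← map_sub, ← map_add]
    exact ⟨_, rfl⟩

theorem sgtQ_of_neg {h : ℤ} (hh : h < 0) (u v : ℕ) : sgtQ h u v = 0 := if_pos hh

theorem sgtQ_zero (u v : ℕ) : sgtQ 0 u v = 1 := by simp [sgtQ]

theorem sgtQ_succ (n u v : ℕ) :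
    sgtQ ((n : ℤ) + 1) u v = ((-1 : ℚ) ^ (n + 1) / (2 * n + 2).factorial) •
      ((∏ j ∈ Finset.range (2 * n + 1),
          (X u - X v - (n : MvPolynomial ℕ ℚ) + (j : MvPolynomial ℕ ℚ))) *
        (X u - X v)) := by
  have h₀ : ¬ ((n : ℤ) + 1 < 0) := by omega
  have h₁ : (n : ℤ) + 1 ≠ 0 := by omega
  have h₂ : ((n : ℤ) + 1).toNat = n + 1 := by omega
  rw [sgtQ, if_neg h₀, if_neg h₁, h₂, show 2 * (n + 1) - 1 = 2 * n + 1 by omega,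
    show 2 * (n + 1) = 2 * n + 2 by ring]
  congr 2
  refine Finset.prod_congr rfl fun j _ => ?_
  push_cast
  ring

/-- An algebra homomorphism acts on `sgt_h(u, v)` through the image of `X u - X v`. -/
theorem map_sgtQ_congr {φ ψ : MvPolynomial ℕ ℚ →ₐ[ℚ] MvPolynomial ℕ ℚ} {u v : ℕ}
    (hφ : φ (X u - X v) = ψ (X u - X v)) (h : ℤ) : φ (sgtQ h u v) = ψ (sgtQ h u v) := by
  simp only [sgtQ]
  split_ifs <;> simp only [map_zero, map_one, map_smul, map_mul, map_prod, map_add,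
    map_sub φ _ (h : MvPolynomial ℕ ℚ), map_sub ψ _ (h : MvPolynomial ℕ ℚ), map_intCast,
    map_natCast, hφ]

theorem shiftHom_two_sgtQ (h : ℤ) : shiftHom 2 (sgtQ h 0 1) = sgtQ h 0 1 :=
  map_sgtQ_congr (ψ := AlgHom.id ℚ _) (by simp [shiftHom_X_of_ne]) h

theorem shiftHom_two_shiftHom_one_sgtQ (h : ℤ) :
    shiftHom 2 (shiftHom 1 (sgtQ h 0 1)) = shiftHom 1 (sgtQ h 0 1) :=
  map_sgtQ_congr (φ := (shiftHom 2).comp (shiftHom 1))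
    (by simp [shiftHom_X_of_ne, shiftHom_X_self]) h

theorem shiftHom_zero_shiftHom_one_sgtQ (h : ℤ) :
    shiftHom 0 (shiftHom 1 (sgtQ h 0 1)) = sgtQ h 0 1 :=
  map_sgtQ_congr (φ := (shiftHom 0).comp (shiftHom 1)) (ψ := AlgHom.id ℚ _)
    (by simp [shiftHom_X_of_ne, shiftHom_X_self]) h

/-- The second central difference of `d (d - n)(d - n + 1) ⋯ (d + n)` for `n = m + 1`. -/
theorem second_difference_prod {R : Type*} [CommRing R] (d : R) (m : ℕ) :
    2 * ((∏ j ∈ Finset.range (2 * m + 3), (d - (m + 1) + j)) * d)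
      - (∏ j ∈ Finset.range (2 * m + 3), (d + 1 - (m + 1) + j)) * (d + 1)
      - (∏ j ∈ Finset.range (2 * m + 3), (d - 1 - (m + 1) + j)) * (d - 1) =
    -((2 * m + 3) * (2 * m + 4) * ((∏ j ∈ Finset.range (2 * m + 1), (d - m + j)) * d)) := by
  have hmid : ∏ j ∈ Finset.range (2 * m + 3), (d - (m + 1) + j) =
      (d - (m + 1)) * (d + (m + 1)) * ∏ j ∈ Finset.range (2 * m + 1), (d - m + j) := by
    rw [Finset.prod_range_succ, Finset.prod_range_succ', Finset.prod_congr rfl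
      (g := fun j : ℕ => d - m + j) fun j _ => by push_cast; ring]
    push_cast
    ring
  have hup : ∏ j ∈ Finset.range (2 * m + 3), (d + 1 - (m + 1) + j) =
      (d + (m + 1)) * (d + (m + 2)) * ∏ j ∈ Finset.range (2 * m + 1), (d - m + j) := by
    rw [Finset.prod_range_succ, Finset.prod_range_succ, Finset.prod_congr rfl
      (g := fun j : ℕ => d - m + j) fun j _ => by ring]
    push_cast
    ring
  have hdown : ∏ j ∈ Finset.range (2 * m + 3), (d - 1 - (m + 1) + j) =
      (d - (m + 1)) * (d - (m + 2)) * ∏ j ∈ Finset.range (2 * m + 1), (d - m + j) := by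
    rw [Finset.prod_range_succ', Finset.prod_range_succ', Finset.prod_congr rfl
      (g := fun j : ℕ => d - m + j) fun j _ => by push_cast; ring]
    push_cast
    ring
  rw [hmid, hup, hdown]
  ring

theorem fdiffV_fdiffV_sgtQ (h : ℤ) :
    fdiffV 0 (fdiffV 1 (sgtQ h 0 1)) = sgtQ (h - 1) 0 1 := by
  have hd₀ : shiftHom 0 (X 0 - X 1) = X 0 - X 1 + 1 := by
    rw [map_sub, shiftHom_X_self, shiftHom_X_of_ne (by decide)]; ring
  have hd₁ : shiftHom 1 (X 0 - X 1) = X 0 - X 1 - 1 := by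
    rw [map_sub, shiftHom_X_self, shiftHom_X_of_ne (by decide)]; ring
  have hexp : fdiffV 0 (fdiffV 1 (sgtQ h 0 1)) =
      2 * sgtQ h 0 1 - shiftHom 0 (sgtQ h 0 1) - shiftHom 1 (sgtQ h 0 1) := by
    simp only [fdiffV, shiftV_eq_shiftHom, map_sub, shiftHom_zero_shiftHom_one_sgtQ]
    ring
  rw [hexp]
  rcases lt_or_ge h 0 with hneg | hnonneg
  · simp [sgtQ_of_neg hneg, sgtQ_of_neg (show h - 1 < 0 by omega)]
  obtain ⟨n, rfl⟩ := Int.eq_ofNat_of_zero_le hnonneg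
  rcases n with _ | _ | m
  · rw [Nat.cast_zero, sgtQ_zero, sgtQ_of_neg (by omega)]
    simp only [map_one]
    ring
  · have h₁ := sgtQ_succ 0 0 1
    simp only [Nat.cast_zero, zero_add, mul_zero, Finset.prod_range_one, sub_zero, add_zero,
      pow_one] at h₁
    simp only [zero_add, Nat.cast_one, sub_self, sgtQ_zero, h₁, map_smul, map_mul, hd₀, hd₁]
    simp only [MvPolynomial.smul_eq_C_mul]
    have hc : (C ((-1 : ℚ) / (2 : ℕ).factorial) : MvPolynomial ℕ ℚ) * 2 = -1 := by
      rw [← map_ofNat C 2, ← map_mul]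
      norm_num [Nat.factorial]
    linear_combination (-1 : MvPolynomial ℕ ℚ) * hc
  · have h₂ := sgtQ_succ (m + 1) 0 1
    have h₁ := sgtQ_succ m 0 1
    rw [show ((m + 1 + 1 : ℕ) : ℤ) = ((m + 1 : ℕ) : ℤ) + 1 by push_cast; ring,
      show ((m + 1 : ℕ) : ℤ) + 1 - 1 = (m : ℤ) + 1 by push_cast; ring, h₁, h₂]
    simp only [map_smul, map_mul, map_prod, map_add,
      map_sub _ _ (((m + 1 : ℕ)) : MvPolynomial ℕ ℚ), map_natCast, hd₀, hd₁]
    have key := second_difference_prod (X 0 - X 1 : MvPolynomial ℕ ℚ) m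
    have hc : (C ((-1 : ℚ) ^ (m + 1 + 1) / (2 * (m + 1) + 2).factorial) : MvPolynomial ℕ ℚ) *
        ((2 * (m : MvPolynomial ℕ ℚ) + 3) * (2 * (m : MvPolynomial ℕ ℚ) + 4)) =
          -C ((-1 : ℚ) ^ (m + 1) / (2 * m + 2).factorial) := by
      have hm : ((2 * (m : MvPolynomial ℕ ℚ) + 3) * (2 * (m : MvPolynomial ℕ ℚ) + 4)) =
          C ((2 * m + 3) * (2 * m + 4) : ℚ) := by
        simp only [map_mul, map_add, map_natCast, map_ofNat]
      rw [hm, ← map_mul, ← map_neg]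
      congr 1
      rw [show 2 * (m + 1) + 2 = 2 * m + 2 + 1 + 1 by ring, Nat.factorial_succ,
        Nat.factorial_succ]
      have hf : ((2 * m + 2).factorial : ℚ) ≠ 0 := by positivity
      push_cast
      field_simp
      ring
    simp only [MvPolynomial.smul_eq_C_mul]
    rw [show 2 * (m + 1) + 1 = 2 * m + 3 by ring]
    push_cast
    linear_combination C ((-1 : ℚ) ^ (m + 1 + 1) / (2 * (m + 1) + 2).factorial) * key -
      ((∏ j ∈ Finset.range (2 * m + 1),
          (X 0 - X 1 - (m : MvPolynomial ℕ ℚ) + (j : MvPolynomial ℕ ℚ))) *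
        (X 0 - X 1)) * hc

theorem Wop_add (x y : ℕ) (p q : MvPolynomial ℕ ℚ) :
    Wop x y (p + q) = Wop x y p + Wop x y q := by
  simp only [Wop, fdiffV, shiftV_eq_shiftHom, map_add, map_sub]
  ring

theorem Wop_smul (x y : ℕ) (c : ℚ) (p : MvPolynomial ℕ ℚ) :
    Wop x y (c • p) = c • Wop x y p := by
  simp only [Wop, fdiffV, shiftV_eq_shiftHom, map_smul, map_sub, smul_add, smul_sub]

/-- Applying `W_{0,2} W_{1,2}` to a partial sum leaves only the two end terms. -/
theorem Wop_Wop_sum_range (h : ℤ) (f : Polynomial ℚ) (n : ℕ) :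
    Wop 0 2 (Wop 1 2
      (∑ i ∈ Finset.range (n + 1),
        (-1 : ℚ) ^ i •
          (sgtQ (h - (i : ℤ)) 0 1 * Dz^[i] (Polynomial.aeval (X 2 : MvPolynomial ℕ ℚ) f)))) =
    sgtQ h 0 1 * Polynomial.aeval (X 2 : MvPolynomial ℕ ℚ) f +
      (-1 : ℚ) ^ n • (sgtQ (h - n - 1) 0 1 *
        Dz^[n + 1] (Polynomial.aeval (X 2 : MvPolynomial ℕ ℚ) f)) := by
  have hterm (i : ℕ) := Wop_Wop_mul (shiftHom_two_sgtQ (h - i))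
    (shiftHom_two_shiftHom_one_sgtQ (h - i)) (shiftHom_zero_shiftHom_one_sgtQ (h - i))
    (exists_aeval_eq_iterate_Dz f i)
  simp only [fdiffV_fdiffV_sgtQ, ← Function.iterate_succ_apply' Dz] at hterm
  induction n with
  | zero => simpa using hterm 0
  | succ n ih =>
    rw [Finset.sum_range_succ, Wop_add, Wop_add, ih, Wop_smul, Wop_smul, hterm,
      show h - ((n + 1 : ℕ) : ℤ) = h - n - 1 by push_cast; ring, pow_succ]
    simp only [mul_neg, mul_one, neg_smul, smul_add]
    abel

/-- For an integer `h` and a univariate polynomial `f(z)`, with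
`x = X 0`, `y = X 1`, `z = X 2`:
`W_{x,z} W_{y,z} [ Σ_{i≥0} (-1)^i sgt_{h-i}(x,y) ((Δ_z(1+Δ_z))^i f)(z) ] = sgt_h(x,y) f(z)`,
the sum being finite (it is truncated at `i = h.toNat`, beyond which `sgt_{h-i} = 0`). -/
theorem statement10 (h : ℤ) (f : Polynomial ℚ) :
    Wop 0 2 (Wop 1 2
      (∑ i ∈ Finset.range (h.toNat + 1),
        (-1 : ℚ) ^ i •
          (sgtQ (h - (i : ℤ)) 0 1 * Dz^[i] (Polynomial.aeval (X 2 : MvPolynomial ℕ ℚ) f)))) =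
    sgtQ h 0 1 * Polynomial.aeval (X 2 : MvPolynomial ℕ ℚ) f := by
  rw [Wop_Wop_sum_range, sgtQ_of_neg (show h - (h.toNat : ℤ) - 1 < 0 by omega), zero_mul,
    smul_zero, add_zero]
end
end

section
/- Let h and n be non-negative integers with h ≤ n and let S(X_1,…,X_n) be a symmetric polynomial over ℚ. Then S(Δ_{k_1},…,Δ_{k_n})·ḠT_h = S(δ_{k_1},…,δ_{k_n})·ḠT_h as polynomials in k_1,…,k_n. -/
open MvPolynomial

noncomputable section

/-- Index set of an `(h,n)`-trapezoidal array. -/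
def GTIdx (h n : ℕ) : Type := {p : ℕ × ℕ // p.1 ≤ h ∧ p.2 < n - h + p.1}

def mkIdx (h n r c : ℕ) (hr : r ≤ h) (hc : c < n - h + r) : GTIdx h n := ⟨(r, c), hr, hc⟩

/-- The Gelfand–Tsetlin trapezoid conditions. -/
def IsGT (h n : ℕ) (a : GTIdx h n → ℤ) : Prop :=
  ∀ (r c : ℕ) (_ : r < h) (hc : c < n - h + r),
    a (mkIdx h n (r+1) c (by omega) (by omega)) ≤ a (mkIdx h n r c (by omega) hc) ∧
    a (mkIdx h n r c (by omega) hc) ≤ a (mkIdx h n (r+1) (c+1) (by omega) (by omega))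

/-- The number of `(h,n)`-Gelfand–Tsetlin trapezoids with prescribed bottom row `k`. -/
def GTcount (h n : ℕ) (k : Fin n → ℤ) : ℕ :=
  Nat.card {a : GTIdx h n → ℤ //
    IsGT h n a ∧ ∀ i : Fin n, a (mkIdx h n h i.val le_rfl (by have := i.isLt; omega)) = k i}

/-- The inverse shift operator `E_s⁻¹`: substitute `X s - 1` for `X s`. -/
def shiftVinv (s : ℕ) (p : MvPolynomial ℕ ℚ) : MvPolynomial ℕ ℚ :=
  MvPolynomial.aeval (fun t => if t = s then MvPolynomial.X t - 1 else MvPolynomial.X t) p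

/-- The backward difference operator `δ_s = E_s⁻¹ - id`. -/
def bdiffV (s : ℕ) (p : MvPolynomial ℕ ℚ) : MvPolynomial ℕ ℚ :=
  shiftVinv s p - p

/-- Substitution of the commuting operators `D 0, …, D (n-1)` into the polynomial `S` in
`n` variables, applied to the polynomial `g`. -/
def opApply {n : ℕ} (S : MvPolynomial (Fin n) ℚ)
    (D : Fin n → MvPolynomial ℕ ℚ → MvPolynomial ℕ ℚ) (g : MvPolynomial ℕ ℚ) :
    MvPolynomial ℕ ℚ :=
  ∑ d ∈ S.support, S.coeff d • (List.finRange n).foldr (fun i q => (D i)^[d i] q) g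

/-- The primitive of `f : ℤ → ℚ` for the forward difference that vanishes at `0`. -/
def primitiveSum (f : ℤ → ℚ) (b : ℤ) : ℚ :=
  ∑ l ∈ Finset.Ico 0 b, f l - ∑ l ∈ Finset.Ico b 0, f l

/-- The signed sum of `f` over the half-open interval from `a` to `b`. -/
def signedSum (a b : ℤ) (f : ℤ → ℚ) : ℚ :=
  primitiveSum f b - primitiveSum f a

section SignedSum

variable (a b c : ℤ) (f g : ℤ → ℚ)

lemma primitiveSum_succ : primitiveSum f (b + 1) = primitiveSum f b + f b := by
  unfold primitiveSum
  rcases le_or_gt 0 b with hb | hb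
  · rw [← Finset.insert_Ico_right_eq_Ico_add_one hb, Finset.sum_insert (by simp),
      Finset.Ico_eq_empty_of_le hb, Finset.Ico_eq_empty_of_le (by omega : (0 : ℤ) ≤ b + 1)]
    simp [add_comm]
  · rw [← Finset.insert_Ico_add_one_left_eq_Ico hb, Finset.sum_insert (by simp),
      Finset.Ico_eq_empty_of_le hb.le, Finset.Ico_eq_empty_of_le (by omega : b + 1 ≤ (0 : ℤ))]
    simp

lemma signedSum_self : signedSum a a f = 0 := sub_self _

lemma signedSum_symm : signedSum a b f = -signedSum b a f := (neg_sub _ _).symm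

lemma signedSum_succ : signedSum a (b + 1) f = signedSum a b f + f b := by
  simp only [signedSum, primitiveSum_succ]; ring

lemma signedSum_trans : signedSum a b f + signedSum b c f = signedSum a c f := by
  simp only [signedSum]; ring

lemma signedSum_add :
    signedSum a b (fun l => f l + g l) = signedSum a b f + signedSum a b g := by
  simp only [signedSum, primitiveSum, Finset.sum_add_distrib]; ring

lemma signedSum_sub :
    signedSum a b (fun l => f l - g l) = signedSum a b f - signedSum a b g := by
  simp only [signedSum, primitiveSum, Finset.sum_sub_distrib]; ring

lemma signedSum_const_mul (r : ℚ) :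
    signedSum a b (fun l => r * f l) = r * signedSum a b f := by
  simp only [signedSum, primitiveSum, ← Finset.mul_sum]; ring

lemma signedSum_neg : signedSum a b (fun l => -f l) = -signedSum a b f := by
  simpa using signedSum_const_mul a b f (-1)

lemma signedSum_mul_const (r : ℚ) :
    signedSum a b (fun l => f l * r) = signedSum a b f * r := by
  simp only [signedSum, primitiveSum, ← Finset.sum_mul]; ring

lemma signedSum_zero : signedSum a b (fun _ => 0) = 0 := by
  simp [signedSum, primitiveSum]

lemma signedSum_comm (a' b' : ℤ) (k : ℤ → ℤ → ℚ) :
    signedSum a b (fun l => signedSum a' b' fun l' => k l l') =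
      signedSum a' b' (fun l' => signedSum a b fun l => k l l') := by
  simp only [signedSum, primitiveSum, Finset.sum_sub_distrib]
  rw [Finset.sum_comm (s := Finset.Ico 0 b) (t := Finset.Ico 0 b'),
    Finset.sum_comm (s := Finset.Ico 0 b) (t := Finset.Ico b' 0),
    Finset.sum_comm (s := Finset.Ico 0 b) (t := Finset.Ico 0 a'),
    Finset.sum_comm (s := Finset.Ico 0 b) (t := Finset.Ico a' 0),
    Finset.sum_comm (s := Finset.Ico b 0) (t := Finset.Ico 0 b'),
    Finset.sum_comm (s := Finset.Ico b 0) (t := Finset.Ico b' 0),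
    Finset.sum_comm (s := Finset.Ico b 0) (t := Finset.Ico 0 a'),
    Finset.sum_comm (s := Finset.Ico b 0) (t := Finset.Ico a' 0),
    Finset.sum_comm (s := Finset.Ico 0 a) (t := Finset.Ico 0 b'),
    Finset.sum_comm (s := Finset.Ico 0 a) (t := Finset.Ico b' 0),
    Finset.sum_comm (s := Finset.Ico 0 a) (t := Finset.Ico 0 a'),
    Finset.sum_comm (s := Finset.Ico 0 a) (t := Finset.Ico a' 0),
    Finset.sum_comm (s := Finset.Ico a 0) (t := Finset.Ico 0 b'),
    Finset.sum_comm (s := Finset.Ico a 0) (t := Finset.Ico b' 0),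
    Finset.sum_comm (s := Finset.Ico a 0) (t := Finset.Ico 0 a'),
    Finset.sum_comm (s := Finset.Ico a 0) (t := Finset.Ico a' 0)]
  ring

lemma signedSum_shift :
    signedSum (a + c) (b + c) f = signedSum a b (fun l => f (l + c)) := by
  induction b using Int.inductionOn' (b := a) with
  | zero => simp [signedSum_self]
  | succ k _ ih => rw [signedSum_succ, ← ih, ← signedSum_succ, add_right_comm]
  | pred k _ ih =>
    have h₁ := signedSum_succ (a + c) (k - 1 + c) f
    have h₂ := signedSum_succ a (k - 1) (fun l => f (l + c))
    rw [show k - 1 + c + 1 = k + c by ring] at h₁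
    rw [sub_add_cancel] at h₂
    linarith

lemma signedSum_eq_sum_Ico (hab : a ≤ b) :
    signedSum a b f = ∑ l ∈ Finset.Ico a b, f l := by
  induction b, hab using Int.leInduction with
  | base => simp [signedSum_self]
  | succ k hk ih =>
    rw [signedSum_succ, ih, ← Finset.insert_Ico_right_eq_Ico_add_one hk,
      Finset.sum_insert (by simp), add_comm]

lemma two_mul_signedSum_signedSum {k r : ℤ → ℤ → ℚ} (hk : ∀ l l', k l l' + k l' l = r l l') :
    2 * signedSum a b (fun l => signedSum a b fun l' => k l l') =
      signedSum a b (fun l => signedSum a b fun l' => r l l') := by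
  simp only [← hk, signedSum_add]
  rw [signedSum_comm a b a b (fun l l' => k l' l)]
  ring

end SignedSum

/-- The sum of `F` over all rows interlacing a given row, where the entry between the
neighbours `x` and `y` runs through the signed half-open interval from `x` to `y`. -/
def interlaceSum : (List ℤ → ℚ) → List ℤ → ℚ
  | _, [] => 0
  | F, [_] => F []
  | F, x :: y :: w => signedSum x y fun l => interlaceSum (fun L => F (l :: L)) (y :: w)

lemma interlaceSum_add (F G : List ℤ → ℚ) (w : List ℤ) :
    interlaceSum (fun L => F L + G L) w = interlaceSum F w + interlaceSum G w := by
  induction w generalizing F G with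
  | nil => simp [interlaceSum]
  | cons x w ih =>
    cases w with
    | nil => simp [interlaceSum]
    | cons y w => simp only [interlaceSum, ih, signedSum_add]

lemma interlaceSum_sub (F G : List ℤ → ℚ) (w : List ℤ) :
    interlaceSum (fun L => F L - G L) w = interlaceSum F w - interlaceSum G w := by
  induction w generalizing F G with
  | nil => simp [interlaceSum]
  | cons x w ih =>
    cases w with
    | nil => simp [interlaceSum]
    | cons y w => simp only [interlaceSum, ih, signedSum_sub]

lemma interlaceSum_const_mul (r : ℚ) (F : List ℤ → ℚ) (w : List ℤ) :
    interlaceSum (fun L => r * F L) w = r * interlaceSum F w := by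
  induction w generalizing F with
  | nil => simp [interlaceSum]
  | cons x w ih =>
    cases w with
    | nil => simp [interlaceSum]
    | cons y w => simp only [interlaceSum, ih, signedSum_const_mul]

lemma interlaceSum_zero (w : List ℤ) : interlaceSum (fun _ => 0) w = 0 := by
  simpa using interlaceSum_const_mul 0 (fun _ => 0) w

/-- Symmetrizing `F` in two adjacent entries splits off a factor `R` depending only on
these two entries. -/
def SymmetrizationFactors (R : ℤ → ℤ → ℚ) (F : List ℤ → ℚ) : Prop :=
  ∀ u x y w, F (u ++ x :: y :: w) + F (u ++ y :: x :: w) = R x y * F (u ++ w)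

/-- The factor split off by `interlaceSum F` when `F` splits off `R`. -/
def interlaceFactor (R : ℤ → ℤ → ℚ) (x y : ℤ) : ℚ :=
  -(signedSum x y fun l => signedSum x y fun l' => R l l') / 2

namespace SymmetrizationFactors

variable {R : ℤ → ℤ → ℚ} {F : List ℤ → ℚ}

lemma cons (hF : SymmetrizationFactors R F) (l : ℤ) :
    SymmetrizationFactors R (fun L => F (l :: L)) :=
  fun u => hF (l :: u)

lemma interlaceSum_add_swap (hF : SymmetrizationFactors R F) (l l' : ℤ) (w : List ℤ) :
    interlaceSum (fun L => F (l :: l' :: L)) w + interlaceSum (fun L => F (l' :: l :: L)) w =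
      R l l' * interlaceSum F w := by
  rw [← interlaceSum_add, ← interlaceSum_const_mul]
  congr 1
  funext L
  exact hF [] l l' L

lemma signedSum_interlaceSum (hF : SymmetrizationFactors R F) (x y : ℤ) (w : List ℤ) :
    (signedSum x y fun l => signedSum x y fun l' =>
      interlaceSum (fun L => F (l :: l' :: L)) w) = -interlaceFactor R x y * interlaceSum F w := by
  have h₁ := two_mul_signedSum_signedSum x y (fun l l' => hF.interlaceSum_add_swap l l' w)
  simp only [signedSum_mul_const] at h₁
  rw [interlaceFactor]
  linarith

lemma interlaceSum_cons_cons (hF : SymmetrizationFactors R F) (x y : ℤ) (w : List ℤ) :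
    interlaceSum F (x :: y :: w) + interlaceSum F (y :: x :: w) =
      interlaceFactor R x y * interlaceSum F w := by
  cases w with
  | nil =>
    simp only [interlaceSum, mul_zero]
    rw [signedSum_trans, signedSum_self]
  | cons b w =>
    have h₁ := hF.signedSum_interlaceSum x y (b :: w)
    simp only [interlaceSum]
    simp only [← signedSum_trans x y b, signedSum_add]
    simp only [signedSum_symm y x]
    linarith

lemma triple_signedSum {x y a b : ℤ} {k : ℤ → ℤ → ℤ → ℚ} {g : ℤ → ℚ}
    (h₁₂ : ∀ l₁ l₂ l₃, k l₁ l₂ l₃ + k l₂ l₁ l₃ = R l₁ l₂ * g l₃)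
    (h₂₃ : ∀ l₁ l₂ l₃, k l₁ l₂ l₃ + k l₁ l₃ l₂ = R l₂ l₃ * g l₁) :
    (signedSum a x fun l₁ => signedSum x y fun l₂ => signedSum y b fun l₃ => k l₁ l₂ l₃) +
      (signedSum a y fun l₁ => signedSum y x fun l₂ => signedSum x b fun l₃ => k l₁ l₂ l₃) =
    interlaceFactor R x y * signedSum a b g := by
  -- a sum over `A × [x, y) × [x, y)`
  have hright (c d : ℤ) :
      (signedSum c d fun l₁ => signedSum x y fun l₂ => signedSum x y fun l₃ => k l₁ l₂ l₃) =
        -interlaceFactor R x y * signedSum c d g := by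
    rw [← signedSum_const_mul]
    congr 1
    funext l₁
    have h := two_mul_signedSum_signedSum x y (h₂₃ l₁)
    simp only [signedSum_mul_const] at h
    rw [interlaceFactor]
    linarith
  -- a sum over `[x, y) × [x, y) × A`
  have hleft (c d : ℤ) :
      (signedSum x y fun l₁ => signedSum x y fun l₂ => signedSum c d fun l₃ => k l₁ l₂ l₃) =
        -interlaceFactor R x y * signedSum c d g := by
    have h := two_mul_signedSum_signedSum x y
      (k := fun l₁ l₂ => signedSum c d fun l₃ => k l₁ l₂ l₃)
      (r := fun l₁ l₂ => R l₁ l₂ * signedSum c d g)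
      (fun l₁ l₂ => by rw [← signedSum_add, ← signedSum_const_mul]; simp only [h₁₂])
    simp only [signedSum_mul_const] at h
    rw [interlaceFactor]
    linarith
  have e₁ := hright a x
  have e₂ := hleft y b
  have e₃ := hright x y
  simp only [← signedSum_trans a x y, ← signedSum_trans x y b, signedSum_symm y x,
    signedSum_neg, signedSum_add]
  rw [← signedSum_trans a x b g, ← signedSum_trans x y b g]
  linarith

/-- The factorization property is inherited by `interlaceSum`. -/
lemma interlace (hF : SymmetrizationFactors R F) :
    SymmetrizationFactors (interlaceFactor R) (interlaceSum F) := by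
  intro u x y w
  induction u generalizing F with
  | nil => exact hF.interlaceSum_cons_cons x y w
  | cons a u ih =>
    cases u with
    | cons a' u =>
      have h := fun l => ih (hF.cons l)
      simp only [List.cons_append] at h
      simp only [List.cons_append, interlaceSum]
      rw [← signedSum_add]
      simp only [h]
      rw [signedSum_const_mul]
    | nil =>
      simp only [List.cons_append, List.nil_append]
      cases w with
      | nil =>
        have h := two_mul_signedSum_signedSum x y (fun l l' => hF [] l l' [])
        simp only [List.nil_append, signedSum_mul_const] at h
        simp only [interlaceSum, ← signedSum_trans a x y, signedSum_symm y x, signedSum_neg,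
          interlaceFactor]
        linarith
      | cons b w =>
        simp only [interlaceSum]
        refine triple_signedSum
          (k := fun l₁ l₂ l₃ => interlaceSum (fun L => F (l₁ :: l₂ :: l₃ :: L)) (b :: w))
          (g := fun l => interlaceSum (fun L => F (l :: L)) (b :: w)) ?_ ?_
        · intro l₁ l₂ l₃
          rw [← interlaceSum_add, ← interlaceSum_const_mul]
          congr 1
          funext L
          exact hF [] l₁ l₂ (l₃ :: L)
        · intro l₁ l₂ l₃
          exact (hF.cons l₁).interlaceSum_add_swap l₂ l₃ (b :: w)

end SymmetrizationFactors

/-- The sum over all entries of the central difference of `F` with step `m`. -/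
def centralDiff (m : ℤ) : (List ℤ → ℚ) → List ℤ → ℚ
  | _, [] => 0
  | F, x :: w => F ((x + m) :: w) - F ((x - m) :: w) + centralDiff m (fun L => F (x :: L)) w

lemma interlaceFactor_add_right {R : ℤ → ℤ → ℚ} (hR : ∀ x y c, R (x + c) (y + c) = R x y)
    (x y c : ℤ) : interlaceFactor R (x + c) (y + c) = interlaceFactor R x y := by
  simp only [interlaceFactor, signedSum_shift, hR]

lemma centralDiff_signedSum (m a b : ℤ) (F : ℤ → List ℤ → ℚ) (w : List ℤ) :
    centralDiff m (fun L => signedSum a b fun l => F l L) w =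
      signedSum a b fun l => centralDiff m (F l) w := by
  induction w generalizing F with
  | nil => simp [centralDiff, signedSum_zero]
  | cons x w ih => simp only [centralDiff, ih, signedSum_add, signedSum_sub]

lemma SymmetrizationFactors.centralDiff_interlaceSum {R : ℤ → ℤ → ℚ} {F : List ℤ → ℚ}
    (hF : SymmetrizationFactors R F) (hR : ∀ x y c, R (x + c) (y + c) = R x y)
    (m : ℤ) (w : List ℤ) :
    centralDiff m (interlaceSum F) w = interlaceSum (centralDiff m F) w := by
  induction w generalizing F with
  | nil => rfl
  | cons x w ih =>
    cases w with
    | nil => simp [centralDiff, interlaceSum]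
    | cons y w =>
      have ih' := fun l => ih (hF.cons l)
      have hkey : (signedSum y (y + m) fun l =>
            interlaceSum (fun L => F (l :: L)) ((y + m) :: w)) +
          (signedSum (y - m) y fun l =>
            interlaceSum (fun L => F (l :: L)) ((y - m) :: w)) =
          signedSum (y - m) (y + m) fun l =>
            interlaceSum (fun L => F (l :: L)) (y :: w) := by
        cases w with
        | nil =>
          simp only [interlaceSum]
          rw [add_comm, signedSum_trans]
        | cons b w =>
          have e₁ := hF.signedSum_interlaceSum y (y + m) (b :: w)
          have e₂ := hF.signedSum_interlaceSum (y - m) y (b :: w)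
          have e₃ := interlaceFactor_add_right hR (y - m) y m
          rw [sub_add_cancel] at e₃
          rw [e₃] at e₁
          simp only [interlaceSum]
          simp only [← signedSum_trans (y - m) y (y + m), ← signedSum_trans (y - m) y b]
          simp only [← signedSum_trans y (y + m) b, signedSum_add]
          linarith
      have hinner : centralDiff m (fun L => interlaceSum F (x :: L)) (y :: w) =
          (signedSum (y - m) (y + m) fun l =>
            interlaceSum (fun L => F (l :: L)) (y :: w)) +
          signedSum x y fun l => interlaceSum (centralDiff m fun L => F (l :: L)) (y :: w) := by
        simp only [← ih', ← hkey, centralDiff, interlaceSum, centralDiff_signedSum, signedSum_add,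
          signedSum_sub]
        simp only [signedSum]
        ring
      have hshift : (signedSum x y fun l => interlaceSum (fun L => F ((l + m) :: L)) (y :: w)) -
          (signedSum x y fun l => interlaceSum (fun L => F ((l - m) :: L)) (y :: w)) =
          (signedSum (y - m) (y + m) fun l => interlaceSum (fun L => F (l :: L)) (y :: w)) -
          signedSum (x - m) (x + m) fun l => interlaceSum (fun L => F (l :: L)) (y :: w) := by
        have h₁ := signedSum_shift x y m fun l => interlaceSum (fun L => F (l :: L)) (y :: w)
        have h₂ := signedSum_shift x y (-m) fun l => interlaceSum (fun L => F (l :: L)) (y :: w)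
        simp only [← sub_eq_add_neg] at h₂
        rw [← h₁, ← h₂]
        simp only [signedSum]
        ring
      rw [centralDiff, hinner]
      simp only [interlaceSum, centralDiff, interlaceSum_add, interlaceSum_sub, signedSum_add,
        signedSum_sub]
      rw [hshift]
      simp only [signedSum]
      ring

/-- The number of trapezoids of height `h` with strictly increasing bottom row, extended to
all integer rows by signed summation. -/
def trapezoidSum : ℕ → List ℤ → ℚ
  | 0 => fun _ => 1
  | h + 1 => interlaceSum (trapezoidSum h)

lemma exists_symmetrizationFactors_trapezoidSum (h : ℕ) :
    ∃ R : ℤ → ℤ → ℚ, (∀ x y c, R (x + c) (y + c) = R x y) ∧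
      SymmetrizationFactors R (trapezoidSum h) := by
  induction h with
  | zero => exact ⟨fun _ _ => 2, fun _ _ _ => rfl, fun _ _ _ _ => by norm_num [trapezoidSum]⟩
  | succ h ih =>
    obtain ⟨R, hR, hF⟩ := ih
    exact ⟨interlaceFactor R, interlaceFactor_add_right hR, hF.interlace⟩

lemma centralDiff_trapezoidSum (m : ℤ) (h : ℕ) (w : List ℤ) :
    centralDiff m (trapezoidSum h) w = 0 := by
  induction h generalizing w with
  | zero =>
    induction w with
    | nil => rfl
    | cons x w ih => simpa [centralDiff, trapezoidSum] using ih
  | succ h ih =>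
    obtain ⟨R, hR, hF⟩ := exists_symmetrizationFactors_trapezoidSum h
    rw [trapezoidSum, hF.centralDiff_interlaceSum hR, show centralDiff m (trapezoidSum h) =
      fun _ => 0 from funext ih, interlaceSum_zero]

lemma interlaceSum_ofFn {n : ℕ} (F : List ℤ → ℚ) (v : Fin (n + 1) → ℤ) (hv : Monotone v) :
    interlaceSum F (List.ofFn v) =
      ∑ l ∈ Fintype.piFinset fun i : Fin n => Finset.Ico (v i.castSucc) (v i.succ),
        F (List.ofFn l) := by
  induction n generalizing F with
  | zero => simp [interlaceSum, Finset.sum_unique_nonempty]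
  | succ n ih =>
    have htail (l : ℤ) := ih (fun L => F (l :: L)) (fun i => v i.succ)
      (hv.comp Fin.strictMono_succ.monotone)
    rw [List.ofFn_succ]
    conv_lhs => rw [List.ofFn_succ]
    rw [interlaceSum, ← List.ofFn_succ (f := fun i => v i.succ), signedSum_eq_sum_Ico _ _ _
      (hv (Fin.zero_le _))]
    simp only [htail]
    rw [← Finset.sum_product']
    refine Finset.sum_equiv (Fin.consEquiv fun _ => ℤ) ?_ ?_
    · rintro ⟨l, t⟩
      simp [Fin.consEquiv, Fintype.mem_piFinset, Fin.forall_fin_succ]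
    · rintro ⟨l, t⟩ _
      simp [Fin.consEquiv, List.ofFn_succ]

/-- The Gelfand–Tsetlin trapezoids with bottom row `k`. -/
abbrev Trapezoid (h n : ℕ) (k : Fin n → ℤ) : Type :=
  {a : GTIdx h n → ℤ //
    IsGT h n a ∧ ∀ i : Fin n, a (mkIdx h n h i.val le_rfl (by have := i.isLt; omega)) = k i}

instance subsingleton_trapezoid_zero (n : ℕ) (k : Fin n → ℤ) : Subsingleton (Trapezoid 0 n k) := by
  refine ⟨fun a b => Subtype.ext (funext ?_)⟩
  rintro ⟨⟨r, c⟩, hr, hc⟩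
  obtain rfl : r = 0 := Nat.le_zero.mp hr
  exact (a.2.2 ⟨c, by simpa using hc⟩).trans (b.2.2 ⟨c, by simpa using hc⟩).symm

lemma GTcount_zero (n : ℕ) (k : Fin n → ℤ) : GTcount 0 n k = 1 := by
  have : Nonempty (Trapezoid 0 n k) :=
    ⟨fun p => k ⟨p.1.2, by have := p.2; omega⟩, fun r c hr => absurd hr (Nat.not_lt_zero r),
      fun i => rfl⟩
  exact Nat.card_unique

/-- The rows interlacing the row `k`. -/
abbrev interlacingRows {n : ℕ} (k : Fin (n + 1) → ℤ) : Finset (Fin n → ℤ) :=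
  Fintype.piFinset fun i => Finset.Icc (k i.castSucc) (k i.succ)

section Rows

variable {h n : ℕ} {k : Fin (n + 1) → ℤ}

/-- The row above the bottom row. -/
def Trapezoid.upperRow (hhn : h ≤ n) (a : Trapezoid (h + 1) (n + 1) k) : interlacingRows k :=
  ⟨fun i => a.1 (mkIdx (h + 1) (n + 1) h i.val (by omega) (by have := i.isLt; omega)), by
    refine Fintype.mem_piFinset.mpr fun i => Finset.mem_Icc.mpr ?_
    have hi := a.2.1 h i.val (by omega) (by have := i.isLt; omega)
    rw [← a.2.2 i.castSucc, ← a.2.2 i.succ]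
    exact hi⟩

/-- Removing the bottom row identifies the trapezoids with given two lowest rows with the
trapezoids with one row less. -/
def Trapezoid.removeBottomRow (hhn : h ≤ n) (l : interlacingRows k) :
    {a : Trapezoid (h + 1) (n + 1) k // a.upperRow hhn = l} ≃ Trapezoid h n l.1 where
  toFun a := ⟨fun p => a.1.1 ⟨p.1, by have := p.2; omega⟩,
    fun r c hr hc => a.1.2.1 r c (by omega) (by omega),
    fun i => congrFun (congrArg Subtype.val a.2) i⟩
  invFun b := ⟨⟨fun p => if hp : p.1.1 ≤ h then b.1 ⟨p.1, hp, by have := p.2; omega⟩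
      else k ⟨p.1.2, by have := p.2; omega⟩, by
    refine ⟨fun r c hr hc => ?_, fun i => by simp [mkIdx]⟩
    rcases Nat.lt_succ_iff_lt_or_eq.mp hr with hr | rfl
    · have := b.2.1 r c hr (by omega)
      simpa [mkIdx, hr.le, hr] using this
    · have h₁ := b.2.2 ⟨c, by omega⟩
      have h₂ := Finset.mem_Icc.mp (Fintype.mem_piFinset.mp l.2 ⟨c, by omega⟩)
      rw [← h₁] at h₂
      simpa [mkIdx] using h₂⟩, by
    refine Subtype.ext (funext fun i => ?_)
    have := b.2.2 i
    simpa [Trapezoid.upperRow, mkIdx] using this⟩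
  left_inv a := by
    refine Subtype.ext (Subtype.ext (funext ?_))
    rintro ⟨⟨r, c⟩, hr, hc⟩
    by_cases hrh : r ≤ h
    · simp [hrh]
    · obtain rfl : r = h + 1 := by dsimp at hr; omega
      have := a.1.2.2 ⟨c, by dsimp at hc; omega⟩
      simpa [hrh, mkIdx] using this.symm
  right_inv b := by
    refine Subtype.ext (funext ?_)
    rintro ⟨⟨r, c⟩, hr, hc⟩
    have hr' : r ≤ h := hr
    simp [hr']

end Rows

lemma finite_trapezoid {h n : ℕ} (hhn : h ≤ n) (k : Fin n → ℤ) : Finite (Trapezoid h n k) := by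
  induction h generalizing n with
  | zero => infer_instance
  | succ h ih =>
    obtain ⟨n, rfl⟩ : ∃ n', n = n' + 1 := ⟨n - 1, by omega⟩
    have hhn' : h ≤ n := by omega
    have (l : interlacingRows k) :
        Finite {a : Trapezoid (h + 1) (n + 1) k // a.upperRow hhn' = l} :=
      have := ih hhn' l.1
      Finite.of_equiv _ (Trapezoid.removeBottomRow hhn' l).symm
    exact Finite.of_equiv _ (Equiv.sigmaFiberEquiv (Trapezoid.upperRow (k := k) hhn'))

lemma GTcount_succ {h n : ℕ} (hhn : h ≤ n) (k : Fin (n + 1) → ℤ) :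
    GTcount (h + 1) (n + 1) k = ∑ l ∈ interlacingRows k, GTcount h n l := by
  have (l : interlacingRows k) : Finite (Trapezoid h n l.1) := finite_trapezoid hhn l.1
  calc GTcount (h + 1) (n + 1) k
      = Nat.card (Σ l : interlacingRows k, Trapezoid h n l.1) :=
        Nat.card_congr ((Equiv.sigmaFiberEquiv (Trapezoid.upperRow hhn)).symm.trans
          (Equiv.sigmaCongrRight (Trapezoid.removeBottomRow hhn)))
    _ = ∑ l : interlacingRows k, GTcount h n l.1 := Nat.card_sigma
    _ = ∑ l ∈ interlacingRows k, GTcount h n l := Finset.sum_coe_sort _ _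

/-- On strictly increasing rows, `trapezoidSum` counts Gelfand–Tsetlin trapezoids. -/
lemma GTcount_eq_trapezoidSum {h n : ℕ} (hhn : h ≤ n) (v : Fin n → ℤ) (hv : StrictMono v) :
    (GTcount h n (fun i => v i - (i.val + 1)) : ℚ) = trapezoidSum h (List.ofFn v) := by
  induction h generalizing n with
  | zero => simp [GTcount_zero, trapezoidSum]
  | succ h ih =>
    obtain ⟨n, rfl⟩ : ∃ n', n = n' + 1 := ⟨n - 1, by omega⟩
    have hhn' : h ≤ n := by omega
    rw [GTcount_succ hhn', trapezoidSum, interlaceSum_ofFn _ _ hv.monotone, Nat.cast_sum]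
    refine Finset.sum_equiv (Equiv.addRight fun i : Fin n => (i.val + 1 : ℤ)) ?_ ?_
    · intro l
      simp only [Fintype.mem_piFinset, Finset.mem_Icc, Finset.mem_Ico, Equiv.coe_addRight,
        Pi.add_apply, Fin.val_castSucc, Fin.val_succ, Nat.cast_add, Nat.cast_one]
      refine forall_congr' fun i => ?_
      constructor <;> intro hi <;> omega
    · intro l hl
      rw [← ih hhn']
      · simp
      · cases n with
        | zero => exact fun i => i.elim0
        | succ n =>
          refine Fin.strictMono_iff_lt_succ.mpr fun i => ?_
          have h₁ := Finset.mem_Icc.mp (Fintype.mem_piFinset.mp hl i.castSucc)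
          have h₂ := Finset.mem_Icc.mp (Fintype.mem_piFinset.mp hl i.succ)
          simp only [Fin.val_castSucc, Fin.val_succ, Nat.cast_add,
            Nat.cast_one, Fin.succ_castSucc] at h₁ h₂
          simp only [Equiv.coe_addRight, Pi.add_apply, Fin.val_castSucc, Fin.val_succ,
            Nat.cast_add, Nat.cast_one]
          omega

lemma centralDiff_ofFn {n : ℕ} (m : ℤ) (F : List ℤ → ℚ) (v : Fin n → ℤ) :
    centralDiff m F (List.ofFn v) =
      ∑ i, (F (List.ofFn (Function.update v i (v i + m))) -
        F (List.ofFn (Function.update v i (v i - m)))) := by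
  induction n generalizing F with
  | zero => simp [centralDiff]
  | succ n ih =>
    rw [List.ofFn_succ, centralDiff, ih, Fin.sum_univ_succ]
    congr 1
    · simp [List.ofFn_succ, Function.update]
    · refine Finset.sum_congr rfl fun i _ => ?_
      have (z : ℤ) : (fun j : Fin n => Function.update v i.succ z j.succ) =
          Function.update (fun j => v j.succ) i z := by
        funext j; simp [Function.update_apply]
      simp only [List.ofFn_succ, this]
      simp [Function.update_of_ne (Fin.succ_ne_zero i).symm]

/-- A subalgebra containing the power sums contains every symmetric polynomial. -/
lemma MvPolynomial.IsSymmetric.mem_of_psum_mem {n : ℕ}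
    (B : Subalgebra ℚ (MvPolynomial (Fin n) ℚ)) (hB : ∀ m, psum (Fin n) ℚ m ∈ B)
    {S : MvPolynomial (Fin n) ℚ} (hS : S.IsSymmetric) : S ∈ B := by
  have hesymm (m : ℕ) : esymm (Fin n) ℚ m ∈ B := by
    induction m using Nat.strong_induction_on with
    | _ m ih =>
      rcases Nat.eq_zero_or_pos m with rfl | hm
      · rw [esymm_zero]; exact one_mem B
      · have hmem : (m : MvPolynomial (Fin n) ℚ) * esymm (Fin n) ℚ m ∈ B := by
          rw [mul_esymm_eq_sum]
          refine mul_mem (pow_mem (neg_mem (one_mem B)) _) (sum_mem fun a ha => ?_)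
          exact mul_mem (mul_mem (pow_mem (neg_mem (one_mem B)) _)
            (ih _ (Finset.mem_filter.mp ha).2)) (hB _)
        have hinv := B.smul_mem hmem (m : ℚ)⁻¹
        rw [← nsmul_eq_mul, ← Nat.cast_smul_eq_nsmul ℚ, smul_smul,
          inv_mul_cancel₀ (by positivity), one_smul] at hinv
        exact hinv
  obtain ⟨p, hp⟩ := (esymmAlgEquiv (Fin n) ℚ (Fintype.card_fin n)).surjective ⟨S, hS⟩
  have hp' : aeval (fun i : Fin n => esymm (Fin n) ℚ (i + 1)) p = S := by
    rw [← esymmAlgHom_apply]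
    exact congrArg Subtype.val hp
  rw [← hp']
  have hrange : (aeval fun i : Fin n => esymm (Fin n) ℚ (i + 1)).range ≤ B := by
    rw [← Algebra.adjoin_range_eq_range_aeval, Algebra.adjoin_le_iff]
    rintro _ ⟨i, rfl⟩
    exact hesymm _
  exact hrange ⟨p, rfl⟩

section Operators

open scoped IsMulCommutative

lemma opApply_eq_aeval {n : ℕ} (A : Subalgebra ℚ (Module.End ℚ (MvPolynomial ℕ ℚ)))
    [IsMulCommutative A] (S : MvPolynomial (Fin n) ℚ) (D : Fin n → A) (g : MvPolynomial ℕ ℚ) :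
    opApply S (fun i p => (D i).1 p) g = (aeval D S).1 g := by
  have hfold (L : List (Fin n)) (d : Fin n →₀ ℕ) :
      L.foldr (fun i q => (fun p => (D i).1 p)^[d i] q) g =
        ((L.map fun i => D i ^ d i).prod : A).1 g := by
    induction L with
    | nil => rfl
    | cons i L ih =>
      rw [List.foldr_cons, ih, List.map_cons, List.prod_cons]
      simp [Module.End.pow_apply]
  simp only [opApply, hfold]
  rw [aeval_def, eval₂_eq']
  simp only [Fin.prod_univ_def, ← Algebra.smul_def]
  simp

/-- Equality of the power sums of shifts at `g` implies equality of all symmetric functions of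
the associated differences at `g`. -/
lemma opApply_sub_eq_of_sum_pow_eq {n : ℕ} (E E' : Fin n → Module.End ℚ (MvPolynomial ℕ ℚ))
    (hcomm : ∀ x ∈ Set.range E ∪ Set.range E', ∀ y ∈ Set.range E ∪ Set.range E', x * y = y * x)
    (g : MvPolynomial ℕ ℚ) (hg : ∀ m : ℕ, ∑ i, (E i ^ m) g = ∑ i, (E' i ^ m) g)
    {S : MvPolynomial (Fin n) ℚ} (hS : S.IsSymmetric) :
    opApply S (fun i p => E i p - p) g = opApply S (fun i p => E' i p - p) g := by
  set A := Algebra.adjoin ℚ (Set.range E ∪ Set.range E')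
  have : IsMulCommutative A := Algebra.isMulCommutative_adjoin ℚ hcomm
  let D (i : Fin n) : A := ⟨E i, Algebra.subset_adjoin (Or.inl ⟨i, rfl⟩)⟩ - 1
  let D' (i : Fin n) : A := ⟨E' i, Algebra.subset_adjoin (Or.inr ⟨i, rfl⟩)⟩ - 1
  have hpoly (q : Polynomial ℚ) :
      ∑ i, (Polynomial.aeval (E i) q) g = ∑ i, (Polynomial.aeval (E' i) q) g := by
    simp only [Polynomial.aeval_eq_sum_range, LinearMap.sum_apply, LinearMap.smul_apply]
    rw [Finset.sum_comm]
    conv_rhs => rw [Finset.sum_comm]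
    simp only [← Finset.smul_sum, hg]
  let B : Subalgebra ℚ (MvPolynomial (Fin n) ℚ) :=
    { carrier := {T | (aeval D T).1 g = (aeval D' T).1 g}
      mul_mem' := by
        intro T U hT hU
        change (aeval D (T * U)).1 g = (aeval D' (T * U)).1 g
        calc (aeval D (T * U)).1 g = (aeval D T).1 ((aeval D U).1 g) := by rw [map_mul]; rfl
          _ = (aeval D T * aeval D' U).1 g := by rw [hU]; rfl
          _ = (aeval D' U).1 ((aeval D T).1 g) := by rw [mul_comm]; rfl
          _ = (aeval D' U * aeval D' T).1 g := by rw [hT]; rfl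
          _ = (aeval D' (T * U)).1 g := by rw [mul_comm, map_mul]
      add_mem' := by
        intro T U hT hU
        have hT' : (aeval D T).1 g = (aeval D' T).1 g := hT
        have hU' : (aeval D U).1 g = (aeval D' U).1 g := hU
        change (aeval D (T + U)).1 g = (aeval D' (T + U)).1 g
        simp [hT', hU']
      algebraMap_mem' := by
        intro r
        change (aeval D (algebraMap _ _ r)).1 g = (aeval D' (algebraMap _ _ r)).1 g
        simp only [AlgHom.commutes] }
  have hB (m : ℕ) : psum (Fin n) ℚ m ∈ B := by
    change (aeval D (psum (Fin n) ℚ m)).1 g = (aeval D' (psum (Fin n) ℚ m)).1 g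
    have := hpoly ((Polynomial.X - 1) ^ m)
    simp only [map_pow, map_sub, map_one, Polynomial.aeval_X] at this
    simpa [psum, D, D'] using this
  have hSB : (aeval D S).1 g = (aeval D' S).1 g := hS.mem_of_psum_mem B hB
  rw [← opApply_eq_aeval, ← opApply_eq_aeval] at hSB
  exact hSB

end Operators

/-- Translation of the variable `X s` by `c`. -/
def translateV (s : ℕ) (c : ℚ) : Module.End ℚ (MvPolynomial ℕ ℚ) :=
  (aeval fun t => if t = s then X t + C c else X t : MvPolynomial ℕ ℚ →ₐ[ℚ] _).toLinearMap

lemma eval_translateV (s : ℕ) (c : ℚ) (x : ℕ → ℚ) (p : MvPolynomial ℕ ℚ) :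
    eval x (translateV s c p) = eval (Function.update x s (x s + c)) p := by
  have : (aeval x).comp (aeval fun t => if t = s then X t + C c else X t) =
      (aeval (Function.update x s (x s + c)) : MvPolynomial ℕ ℚ →ₐ[ℚ] ℚ) := by
    ext t
    by_cases ht : t = s
    · subst ht; simp
    · simp [ht]
  exact DFunLike.congr_fun this p

lemma translateV_mul_comm (s t : ℕ) (c d : ℚ) :
    translateV s c * translateV t d = translateV t d * translateV s c := by
  refine LinearMap.ext fun p => MvPolynomial.funext fun x => ?_
  simp only [Module.End.mul_apply, eval_translateV]
  congr 2
  funext u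
  by_cases hst : s = t
  · subst hst
    by_cases hu : u = s
    · subst hu; simp [add_right_comm]
    · simp [hu]
  · by_cases hu : u = s
    · subst hu; simp [hst, Ne.symm hst]
    · by_cases hu' : u = t
      · subst hu'; simp [hst, Ne.symm hst]
      · simp [hu, hu']

lemma eval_translateV_pow (s m : ℕ) (c : ℚ) (x : ℕ → ℚ) (p : MvPolynomial ℕ ℚ) :
    eval x ((translateV s c ^ m) p) = eval (Function.update x s (x s + m * c)) p := by
  induction m generalizing x with
  | zero => simp
  | succ m ih =>
    rw [pow_succ', Module.End.mul_apply, eval_translateV, ih]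
    simp only [Function.update_self, Function.update_idem]
    push_cast
    ring_nf

/-- A polynomial vanishing at all integer points whose first `n` coordinates are increasing with
gaps larger than `m` is zero. -/
lemma eq_zero_of_eval_eq_zero_of_gaps (n m : ℕ) (p : MvPolynomial ℕ ℚ)
    (hp : ∀ v : ℕ → ℤ, (∀ s t : ℕ, s < t → t < n → v s + m < v t) →
      eval (fun u => (v u : ℚ)) p = 0) : p = 0 := by
  refine funext_set (fun _ => Set.range ((↑) : ℤ → ℚ))
    (fun _ => Set.infinite_range_of_injective Int.cast_injective) fun x hx => ?_
  choose q hq using fun s => hx s (Set.mem_univ s)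
  obtain rfl : (fun s => (q s : ℚ)) = x := funext hq
  set P : Polynomial ℚ :=
    aeval (fun s => Polynomial.C (q s : ℚ) + Polynomial.C (s : ℚ) * Polynomial.X) p
  have heval (c : ℚ) : P.eval c = eval (fun s => q s + s * c) p := by
    have : (Polynomial.aeval c).comp
        (aeval fun s => Polynomial.C (q s : ℚ) + Polynomial.C (s : ℚ) * Polynomial.X) =
        (aeval (fun s : ℕ => q s + s * c) : MvPolynomial ℕ ℚ →ₐ[ℚ] ℚ) := by
      ext s; simp
    exact DFunLike.congr_fun this p
  set Q : ℤ := ∑ s ∈ Finset.range n, |q s|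
  have hroot (N : ℕ) (hN : m + 2 * Q < N) : P.IsRoot N := by
    have h := hp (fun s => q s + s * N) fun s t hst htn => by
      have hs : |q s| ≤ Q := Finset.single_le_sum (f := fun s => |q s|)
        (fun _ _ => abs_nonneg _) (Finset.mem_range.mpr (hst.trans htn))
      have ht : |q t| ≤ Q := Finset.single_le_sum (f := fun s => |q s|)
        (fun _ _ => abs_nonneg _) (Finset.mem_range.mpr htn)
      have := neg_abs_le (q t)
      have := le_abs_self (q s)
      have hst' : (s : ℤ) + 1 ≤ t := by exact_mod_cast hst
      nlinarith [Int.natCast_nonneg N]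
    rw [Polynomial.IsRoot, heval]
    simpa using h
  have hP0 : P = 0 := by
    refine Polynomial.eq_zero_of_infinite_isRoot P (Set.Infinite.mono
      (s := Set.image ((↑) : ℕ → ℚ) (Set.Ioi (m + 2 * Q).toNat)) ?_
      ((Set.Ioi_infinite _).image Nat.cast_injective.injOn))
    rintro _ ⟨N, hN, rfl⟩
    exact hroot N (by have := Set.mem_Ioi.mp hN; omega)
  simpa [hP0] using (heval 0).symm

/-- The variables `k_1,…,k_n` are `X 0, …, X (n-1)`, and `Gb` is the
polynomial `ḠT_h` with `Gb(k_1,…,k_n) = GT_h(k_1-1,…,k_n-n)` for all `k_1 < ⋯ < k_n`.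
For any symmetric polynomial `S(X_1,…,X_n)`,
`S(Δ_{k_1},…,Δ_{k_n}) Gb = S(δ_{k_1},…,δ_{k_n}) Gb`. -/
theorem statement16 (h n : ℕ) (hhn : h ≤ n)
    (Gb : MvPolynomial ℕ ℚ)
    (hGb : ∀ v : ℕ → ℤ, (∀ s t : ℕ, s < t → t < n → v s < v t) →
      MvPolynomial.eval (fun u => (v u : ℚ)) Gb =
        (GTcount h n (fun idx : Fin n => v idx.val - (idx.val + 1)) : ℚ))
    (S : MvPolynomial (Fin n) ℚ) (hS : S.IsSymmetric) :
    opApply S (fun i => fdiffV i.val) Gb = opApply S (fun i => bdiffV i.val) Gb := by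
  have hup (s : ℕ) : fdiffV s = fun p => translateV s 1 p - p := by
    funext p; simp [fdiffV, shiftV, translateV]
  have hdown (s : ℕ) : bdiffV s = fun p => translateV s (-1) p - p := by
    funext p; simp [bdiffV, shiftVinv, translateV, sub_eq_add_neg]
  simp only [hup, hdown]
  refine opApply_sub_eq_of_sum_pow_eq (fun i : Fin n => translateV i 1)
    (fun i => translateV i (-1)) ?_ Gb (fun m => ?_) hS
  · rintro _ (⟨i, rfl⟩ | ⟨i, rfl⟩) _ (⟨j, rfl⟩ | ⟨j, rfl⟩) <;> exact translateV_mul_comm _ _ _ _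
  · rw [← sub_eq_zero, ← Finset.sum_sub_distrib]
    refine eq_zero_of_eval_eq_zero_of_gaps n m _ fun v hv => ?_
    have heval (i : Fin n) (c : ℤ) (hc : |c| ≤ m) :
        eval (Function.update (fun u => (v u : ℚ)) i (v i + c)) Gb =
          trapezoidSum h (List.ofFn (Function.update (fun j : Fin n => v j) i (v i + c))) := by
      have hmono : ∀ s t : ℕ, s < t → t < n →
          Function.update v i (v i + c) s < Function.update v i (v i + c) t := by
        intro s t hst htn
        have := hv s t hst htn
        have := abs_le.mp hc
        simp only [Function.update_apply]
        split_ifs <;> subst_vars <;> omega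
      have hrow : Function.update (fun j : Fin n => v j) i (v i + c) =
          fun j : Fin n => Function.update v i (v i + c) j := by
        funext j; simp [Function.update_apply, Fin.ext_iff]
      rw [hrow, ← GTcount_eq_trapezoidSum hhn _ fun s t hst => hmono s t hst t.isLt,
        ← hGb _ hmono]
      congr 2
      funext u
      simp only [Function.update_apply]
      split_ifs <;> simp
    have hzero := centralDiff_trapezoidSum m h (List.ofFn fun j : Fin n => v j)
    rw [centralDiff_ofFn] at hzero
    rw [map_sum, ← hzero]
    refine Finset.sum_congr rfl fun i _ => ?_
    have h₁ := heval i m (by simp)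
    have h₂ := heval i (-m) (by simp)
    rw [map_sub, eval_translateV_pow, eval_translateV_pow]
    push_cast at h₁ h₂
    rw [mul_one, mul_neg_one, h₁, h₂, sub_eq_add_neg (v i) (m : ℤ)]
end
end

section
/- Let n be a positive integer, let a be a polynomial in n−1 variables over ℚ, and let b(k_1,…,k_n) := Σ_{(l_1,…,l_{n−1}) ≺ (k_1,…,k_n)} a(l_1,…,l_{n−1}), a polynomial in k_1,…,k_n. Then Σ_{i=1}^{n+1} (−1)^i · b(k_1,…,k_{i−1},k_{i+1},…,k_{n+1}) = 0 as a polynomial in k_1,…,k_{n+1}. -/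
open MvPolynomial

noncomputable section

/-- A sum over a box is additive in each side of the box. -/
theorem Fintype.sum_piFinset_eq_add_of_disjoint {ι α M : Type*} [Fintype ι] [DecidableEq ι]
    [DecidableEq α] [AddCommMonoid M] (f : (ι → α) → M) {P Q R : ι → Finset α} (j : ι)
    (hP : ∀ t, t ≠ j → P t = R t) (hQ : ∀ t, t ≠ j → Q t = R t)
    (hj : R j = P j ∪ Q j) (hd : Disjoint (P j) (Q j)) :
    ∑ l ∈ Fintype.piFinset R, f l =
      ∑ l ∈ Fintype.piFinset P, f l + ∑ l ∈ Fintype.piFinset Q, f l := by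
  have hR : Fintype.piFinset R = Fintype.piFinset P ∪ Fintype.piFinset Q := by
    ext l
    simp only [Fintype.mem_piFinset, Finset.mem_union]
    constructor
    · intro h
      have hl := h j
      rw [hj, Finset.mem_union] at hl
      refine hl.imp (fun hl t => ?_) (fun hl t => ?_) <;>
      · by_cases ht : t = j
        · exact ht ▸ hl
        · simpa only [hP t ht, hQ t ht] using h t
    · rintro (h | h) t <;> by_cases ht : t = j
      · subst ht; rw [hj]; exact Finset.mem_union_left _ (h t)
      · exact hP t ht ▸ h t
      · subst ht; rw [hj]; exact Finset.mem_union_right _ (h t)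
      · exact hQ t ht ▸ h t
  rw [hR, Finset.sum_union]
  exact Fintype.piFinset_disjoint_of_disjoint _ _ hd

theorem MvPolynomial.eval_bind₁ {σ τ R : Type*} [CommSemiring R] (x : τ → R)
    (g : σ → MvPolynomial τ R) (p : MvPolynomial σ R) :
    eval x (bind₁ g p) = eval (fun i => eval x (g i)) p :=
  eval₂Hom_bind₁ (RingHom.id R) x g p

/-- A polynomial that vanishes at all integer points with weakly increasing coordinates is zero. -/
theorem MvPolynomial.eq_zero_of_eval_monotone_eq_zero (p : MvPolynomial ℕ ℚ)
    (hp : ∀ v : ℕ → ℤ, Monotone v → eval (fun u => (v u : ℚ)) p = 0) : p = 0 := by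
  have hq : bind₁ (fun i => ∑ j ∈ Finset.range (i + 1), (X j : MvPolynomial ℕ ℚ)) p = 0 := by
    refine funext_set (fun _ => Set.range ((↑) : ℕ → ℚ))
      (fun _ => Set.infinite_range_of_injective Nat.cast_injective) fun x hx => ?_
    choose w hw using fun i => hx i (Set.mem_univ i)
    have hmono : Monotone fun i => ∑ j ∈ Finset.range (i + 1), (w j : ℤ) :=
      monotone_nat_of_le_succ fun i => by
        rw [Finset.sum_range_succ _ (i + 1)]
        exact le_add_of_nonneg_right (Int.natCast_nonneg _)
    have h := hp _ hmono
    simp only [Int.cast_sum, Int.cast_natCast, hw] at h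
    simpa [eval_bind₁] using h
  refine funext fun x => ?_
  have h := congrArg (eval fun i => if i = 0 then x 0 else x i - x (i - 1)) hq
  have hx : ∀ i, ∑ j ∈ Finset.range (i + 1), (if j = 0 then x 0 else x j - x (j - 1)) = x i := by
    intro i
    rw [Finset.sum_range_succ']
    simp only [Nat.add_eq_zero_iff, one_ne_zero, and_false, if_false, if_true,
      Nat.add_sub_cancel, Finset.sum_range_sub, sub_add_cancel]
  simpa [eval_bind₁, hx] using h

/-- The alternating sum over all ways of deleting one of the endpoints `v 0 ≤ ⋯ ≤ v (m + 1)`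
of the box sums with the remaining consecutive endpoints vanishes. -/
theorem sum_alternating_box_sum_eq_zero (m : ℕ) (f : (Fin m → ℤ) → ℚ) {v : ℕ → ℤ}
    (hv : Monotone v) :
    ∑ r ∈ Finset.range (m + 2), (-1 : ℚ) ^ (r + 1) *
      ∑ l ∈ Fintype.piFinset (fun t : Fin m =>
        Finset.Icc (v (if t.val < r then t.val else t.val + 1))
          (v (if t.val + 1 < r then t.val + 1 else t.val + 1 + 1) - 1)), f l = 0 := by
  set S : ℕ → ℚ := fun r => ∑ l ∈ Fintype.piFinset (fun t : Fin m =>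
    Finset.Icc (v (if t.val < r then t.val else t.val + 1))
      (v (if t.val + 1 < r then t.val + 1 else t.val + 1 + 1) - 1)), f l with hS
  set A : ℕ → ℚ := fun r => ∑ l ∈ Fintype.piFinset (fun t : Fin m =>
    Finset.Icc (v (if t.val < r then t.val else t.val + 1))
      (v (if t.val < r then t.val + 1 else t.val + 1 + 1) - 1)), f l with hA
  have hfirst : S 0 = A 0 := by simp [hS, hA]
  have hlast : S (m + 1) = A m := by
    have : ∀ t : Fin m, t.val < m + 1 := fun t => t.isLt.trans (Nat.lt_succ_self m)
    simp [hS, hA, this]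
  have hmid : ∀ j < m, S (j + 1) = A (j + 1) + A j := by
    intro j hj
    refine Fintype.sum_piFinset_eq_add_of_disjoint f ⟨j, hj⟩ ?_ ?_ ?_ ?_
    · intro t ht
      have ht' : t.val ≠ j := fun h => ht (Fin.ext h)
      have : t.val < j + 1 ↔ t.val + 1 < j + 1 := by omega
      simp only [this]
    · intro t ht
      have ht' : t.val ≠ j := fun h => ht (Fin.ext h)
      have h1 : t.val < j + 1 ↔ t.val < j := by omega
      have h2 : t.val + 1 < j + 1 ↔ t.val < j := by omega
      simp only [h1, h2]
    · have h1 := hv (Nat.le_add_right j 1)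
      have h2 := hv (Nat.le_add_right (j + 1) 1)
      ext x
      simp
      omega
    · rw [Finset.disjoint_left]
      intro x
      simp
      omega
  have hpartial : ∀ k ≤ m, ∑ r ∈ Finset.range (k + 1), (-1 : ℚ) ^ (r + 1) * S r
      = (-1) ^ (k + 1) * A k := by
    intro k
    induction k with
    | zero => simp [hfirst]
    | succ k ih =>
      intro hk
      rw [Finset.sum_range_succ, ih (by omega), hmid k (by omega)]
      ring
  change ∑ r ∈ Finset.range (m + 2), (-1 : ℚ) ^ (r + 1) * S r = 0
  rw [Finset.sum_range_succ, hpartial m le_rfl, hlast]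
  ring

/-- The variables `k_1,…,k_n` are `X 0, …, X (n-1)`.  Let
`b(k_1,…,k_n) = Σ_{(l_1,…,l_{n-1}) ≺ (k_1,…,k_n)} a(l_1,…,l_{n-1})` (characterized by its
values at integer points with weakly increasing coordinates).  Then
`Σ_{i=1}^{n+1} (-1)^i b(k_1,…,k_{i-1},k_{i+1},…,k_{n+1}) = 0` as a polynomial in
`k_1,…,k_{n+1}` (the variables `X 0,…,X n`); deleting the `i`-th variable corresponds to
the variable renaming `t ↦ t` for `t < i-1` and `t ↦ t+1` for `t ≥ i-1`. -/
theorem statement18 (n : ℕ) (hn : 1 ≤ n) (a b : MvPolynomial ℕ ℚ)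
    (hb : ∀ v : ℕ → ℤ, (∀ t, t + 1 < n → v t ≤ v (t + 1)) →
      MvPolynomial.eval (fun u => (v u : ℚ)) b =
        ∑ l ∈ Fintype.piFinset (fun t : Fin (n - 1) =>
            Finset.Icc (v t.val) (v (t.val + 1) - 1)),
          MvPolynomial.eval (fun s => if hs : s < n - 1 then ((l ⟨s, hs⟩ : ℤ) : ℚ) else 0) a) :
    ∑ r ∈ Finset.range (n + 1),
        ((-1 : ℚ) ^ (r + 1)) • rename (fun t => if t < r then t else t + 1) b = 0 := by
  obtain ⟨m, rfl⟩ := Nat.exists_eq_add_of_le' hn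
  refine eq_zero_of_eval_monotone_eq_zero _ fun v hv => ?_
  simp only [map_sum, smul_eval, eval_rename]
  rw [← sum_alternating_box_sum_eq_zero m (fun l => eval
    (fun s => if hs : s < m then ((l ⟨s, hs⟩ : ℤ) : ℚ) else 0) a) hv]
  refine Finset.sum_congr rfl fun r _ => ?_
  congr 1
  refine hb (fun t => v (if t < r then t else t + 1)) fun t _ => hv ?_
  split_ifs <;> omega
end
end
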